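/- Let 𝒜 be an abelian category, 𝒳 a full subcategory closed under extensions and under cokernels of monomorphisms, and 𝒲 an 𝒳-projective generator for 𝒳. Given a short exact sequence 0 → K → X → C → 0 with X ∈ 𝒳, the object C has a finite 𝒳-coresolution if and only if K has a finite 𝒳-coresolution. -/

import Mathlib

open CategoryTheory CategoryTheory.Limits Opposite

universe v u

variable {A : Type u} [Category.{v} A] [Abelian A]

/-- `IsSES f g` : `0 → X → Y → Z → 0` is a short exact sequence. -/
def IsSES {X Y Z : A} (f : X ⟶ Y) (g : Y ⟶ Z) : Prop :=
  ∃ w : f ≫ g = 0, (ShortComplex.mk f g w).ShortExact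

/-- `HasCoresLE S n C` : `C` admits a coresolution `0 → C → X₀ → ⋯ → X₋ₙ → 0`
with all terms in `S`. -/
def HasCoresLE (S : Set A) : ℕ → A → Prop
  | 0, C => C ∈ S
  | n+1, C => ∃ (X K : A) (f : C ⟶ X) (g : X ⟶ K), X ∈ S ∧ IsSES f g ∧ HasCoresLE S n K

/-- `S` is closed under extensions. -/
def ExtClosed (S : Set A) : Prop :=
  ∀ ⦃X Y Z : A⦄ (f : X ⟶ Y) (g : Y ⟶ Z), IsSES f g → X ∈ S → Z ∈ S → Y ∈ S

/-- `S` is closed under cokernels of monomorphisms. -/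
def CokerClosed (S : Set A) : Prop :=
  ∀ ⦃X Y Z : A⦄ (f : X ⟶ Y) (g : Y ⟶ Z), IsSES f g → X ∈ S → Y ∈ S → Z ∈ S

/-- `S` is closed under kernels of epimorphisms. -/
def KerClosed (S : Set A) : Prop :=
  ∀ ⦃X Y Z : A⦄ (f : X ⟶ Y) (g : Y ⟶ Z), IsSES f g → Y ∈ S → Z ∈ S → X ∈ S

/-- `W` is a generator for `X` : every object of `X` receives an epimorphism from
an object of `W` with kernel in `X`. -/
def IsGen (W X : Set A) : Prop :=
  W ⊆ X ∧ ∀ C ∈ X, ∃ (X' W₀ : A) (f : X' ⟶ W₀) (g : W₀ ⟶ C),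
    W₀ ∈ W ∧ X' ∈ X ∧ IsSES f g

/-- `Extⁱ(X, Y) = 0`. -/
def ExtVanish [EnoughProjectives A] (i : ℕ) (X Y : A) : Prop :=
  IsZero (((Ext ℤ A i).obj (op X)).obj Y)

/-- `W` is `X`-projective: `Extⁱ(W, X) = 0` for all `i ≥ 1`. -/
def IsXProj [EnoughProjectives A] (W X : Set A) : Prop :=
  ∀ W' ∈ W, ∀ X' ∈ X, ∀ i : ℕ, 1 ≤ i → ExtVanish i W' X'


theorem ext_subsingleton_of_vanish [EnoughProjectives A] [HasExt.{v} A] {Y X : A} (i : ℕ)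
    (h : ExtVanish (i + 1) Y X) : Subsingleton (Abelian.Ext.{v} Y X (i + 1)) := by
  have R : ProjectiveResolution Y := projectiveResolution Y
  have h1 := IsZero.of_iso h (R.isoExt (R := ℤ) (i + 1) X).symm
  rw [← HomologicalComplex.exactAt_iff_isZero_homology,
    HomologicalComplex.exactAt_iff' _ i (i + 1) (i + 2) (by simp) (by simp),
    ShortComplex.moduleCat_exact_iff] at h1
  refine subsingleton_of_forall_eq 0 fun α => ?_
  obtain ⟨f, hf, rfl⟩ := R.extMk_surjective α (i + 2) rfl
  rw [R.extMk_eq_zero_iff f _ _ hf i rfl]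
  obtain ⟨g, hg⟩ := h1 f hf
  exact ⟨g, hg⟩

theorem IsSES.ofCokernel {X Y Z : A} (f : X ⟶ Y) (g : Y ⟶ Z) [Mono f] [Epi g] (w : f ≫ g = 0)
    (h : ∀ {T : A} (k : Y ⟶ T), f ≫ k = 0 → ∃ l, g ≫ l = k) : IsSES f g := by
  refine ⟨w, ?_⟩
  have : (ShortComplex.mk f g w).Exact := by
    apply ShortComplex.exact_of_g_is_cokernel
    exact CokernelCofork.IsColimit.ofπ' g w fun k hk =>
      ⟨(h k hk).choose, (h k hk).choose_spec⟩
  exact { exact := this }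

theorem IsSES.ofKernel {X Y Z : A} (f : X ⟶ Y) (g : Y ⟶ Z) [Mono f] [Epi g] (w : f ≫ g = 0)
    (h : ∀ {T : A} (k : T ⟶ Y), k ≫ g = 0 → ∃ l, l ≫ f = k) : IsSES f g := by
  refine ⟨w, ?_⟩
  have : (ShortComplex.mk f g w).Exact := by
    apply ShortComplex.exact_of_f_is_kernel
    exact KernelFork.IsLimit.ofι' f w fun k hk =>
      ⟨(h k hk).choose, (h k hk).choose_spec⟩
  exact { exact := this }

theorem IsSES.mono {X Y Z : A} {f : X ⟶ Y} {g : Y ⟶ Z} (h : IsSES f g) : Mono f := h.2.mono_f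

theorem IsSES.epi {X Y Z : A} {f : X ⟶ Y} {g : Y ⟶ Z} (h : IsSES f g) : Epi g := h.2.epi_g

theorem IsSES.desc {X Y Z : A} {f : X ⟶ Y} {g : Y ⟶ Z} (h : IsSES f g) {T : A} (k : Y ⟶ T)
    (hk : f ≫ k = 0) : ∃ l, g ≫ l = k := by
  have := h.epi
  exact ⟨h.2.exact.desc k hk, h.2.exact.g_desc k hk⟩

theorem IsSES.lift {X Y Z : A} {f : X ⟶ Y} {g : Y ⟶ Z} (h : IsSES f g) {T : A} (k : T ⟶ Y)
    (hk : k ≫ g = 0) : ∃ l, l ≫ f = k := by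
  have := h.mono
  exact ⟨h.2.exact.lift k hk, h.2.exact.lift_f k hk⟩

theorem IsSES.pushout {K X C Z P : A} {f : K ⟶ X} {g : X ⟶ C} (h : IsSES f g) {a : K ⟶ Z}
    {j : X ⟶ P} {i : Z ⟶ P} (sq : IsPushout f a j i) [Mono i] : ∃ p : P ⟶ C, IsSES i p := by
  have := h.epi
  have e1 : j ≫ sq.desc g 0 (by simp [h.1]) = g := sq.inl_desc _ _ _
  have e2 : i ≫ sq.desc g 0 (by simp [h.1]) = 0 := sq.inr_desc _ _ _
  have : Epi (sq.desc g 0 (by simp [h.1])) := by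
    have : Epi (j ≫ sq.desc g 0 (by simp [h.1])) := by rwa [e1]
    exact epi_of_epi j _
  refine ⟨_, IsSES.ofCokernel _ _ e2 fun k hk => ?_⟩
  obtain ⟨l, hl⟩ := h.desc (j ≫ k) (by rw [← Category.assoc, sq.w, Category.assoc, hk, comp_zero])
  refine ⟨l, sq.hom_ext ?_ ?_⟩
  · rw [← Category.assoc, e1, hl]
  · rw [← Category.assoc, e2, hk, zero_comp]

theorem IsSES.pullback {K X C Z P : A} {f : K ⟶ X} {g : X ⟶ C} (h : IsSES f g) {c : Z ⟶ C}
    {j : P ⟶ X} {i : P ⟶ Z} (sq : IsPullback j i g c) [Epi i] : ∃ p : K ⟶ P, IsSES p i := by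
  have := h.mono
  have e1 : sq.lift f 0 (by simp [h.1]) ≫ j = f := sq.lift_fst _ _ _
  have e2 : sq.lift f 0 (by simp [h.1]) ≫ i = 0 := sq.lift_snd _ _ _
  have : Mono (sq.lift f 0 (by simp [h.1])) := by
    have : Mono (sq.lift f 0 (by simp [h.1]) ≫ j) := by rwa [e1]
    exact mono_of_mono _ j
  refine ⟨_, IsSES.ofKernel _ _ e2 fun k hk => ?_⟩
  obtain ⟨l, hl⟩ := h.lift (k ≫ j) (by
    rw [Category.assoc, sq.w, ← Category.assoc, hk, zero_comp])
  refine ⟨l, sq.hom_ext ?_ ?_⟩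
  · rw [Category.assoc, e1, hl]
  · rw [Category.assoc, e2, hk, comp_zero]

theorem IsSES.third {X P C T Y : A} {u : X ⟶ P} {p : P ⟶ C} (h : IsSES u p) {m : P ⟶ T}
    {n : T ⟶ Y} (h' : IsSES m n) : ∃ (Z : A) (a : X ⟶ T) (b : T ⟶ Z) (c : C ⟶ Z) (d : Z ⟶ Y),
    IsSES a b ∧ IsSES c d := by
  have := h.mono
  have := h.epi
  have := h'.mono
  have := h'.epi
  have sq := IsPushout.of_hasPushout m p
  obtain ⟨d, hd⟩ := h'.pushout sq
  refine ⟨_, u ≫ m, pushout.inl m p, pushout.inr m p, d, ?_, hd⟩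
  refine IsSES.ofCokernel _ _ ?_ fun k hk => ?_
  · rw [Category.assoc, sq.w, ← Category.assoc, h.1, zero_comp]
  · obtain ⟨l, hl⟩ := h.desc (m ≫ k) (by simpa using hk)
    exact ⟨sq.desc k l hl.symm, sq.inl_desc _ _ _⟩

theorem IsSES.third' {X W X₁ L Y : A} {u : X ⟶ W} {p : W ⟶ X₁} (h : IsSES u p) {m : L ⟶ X₁}
    {n : X₁ ⟶ Y} (h' : IsSES m n) : ∃ (Q : A) (a : X ⟶ Q) (b : Q ⟶ L) (c : Q ⟶ W) (d : W ⟶ Y),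
    IsSES a b ∧ IsSES c d := by
  have := h.mono
  have := h.epi
  have := h'.mono
  have := h'.epi
  have sq := IsPullback.of_hasPullback p m
  obtain ⟨d, hd⟩ := h.pullback sq
  refine ⟨_, d, pullback.snd p m, pullback.fst p m, p ≫ n, hd, ?_⟩
  refine IsSES.ofKernel _ _ ?_ fun k hk => ?_
  · rw [← Category.assoc, sq.w, Category.assoc, h'.1, comp_zero]
  · obtain ⟨l, hl⟩ := h'.lift (k ≫ p) (by simpa using hk)
    exact ⟨sq.lift k l hl.symm, sq.lift_fst _ _ _⟩

/-- Left `Ext`-orthogonality to a class of objects. -/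
def LeftOrth [HasExt.{v} A] (S : Set A) (Y : A) : Prop :=
  ∀ X ∈ S, ∀ i : ℕ, Subsingleton (Abelian.Ext.{v} Y X (i + 1))

theorem LeftOrth.of_ses [HasExt.{v} A] {S : Set A} {Q W Y : A} {c : Q ⟶ W} {d : W ⟶ Y}
    (h : IsSES c d) (hW : LeftOrth S W) (hY : LeftOrth S Y) : LeftOrth S Q := by
  intro X hX i
  refine subsingleton_of_forall_eq 0 fun α => ?_
  have h1 := hY X hX (i + 1)
  have h2 := hW X hX i
  obtain ⟨β, hβ⟩ := Abelian.Ext.contravariant_sequence_exact₁ h.2 X α (n₁ := i + 1 + 1)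
    (by lia) (h1.elim _ _)
  rw [← hβ, h2.elim β 0, Abelian.Ext.comp_zero]

theorem exists_retraction [HasExt.{v} A] {X P Y : A} {x : X ⟶ P} {q : P ⟶ Y} (h : IsSES x q)
    (hs : Subsingleton (Abelian.Ext.{v} Y X 1)) : ∃ r : P ⟶ X, x ≫ r = 𝟙 X := by
  obtain ⟨β, hβ⟩ := Abelian.Ext.contravariant_sequence_exact₁ h.2 X (Abelian.Ext.mk₀ (𝟙 X))
    (n₁ := 1) (by lia) (hs.elim _ _)
  obtain ⟨r, rfl⟩ := Abelian.Ext.addEquiv₀.symm.surjective β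
  refine ⟨r, Abelian.Ext.addEquiv₀.symm.injective ?_⟩
  simpa using hβ

theorem isSES_of_retraction {X P Y W Z : A} {x : X ⟶ P} {q : P ⟶ Y} (h : IsSES x q)
    {r : P ⟶ X} (hr : x ≫ r = 𝟙 X) {a : Y ⟶ W} {b : W ⟶ Z} (h' : IsSES a b) :
    IsSES (biprod.lift r (q ≫ a)) (biprod.snd ≫ b : X ⊞ W ⟶ Z) := by
  have := h.epi
  have := h'.mono
  have := h'.epi
  have : Mono (biprod.lift r (q ≫ a)) := by
    refine Preadditive.mono_of_cancel_zero _ fun {T} z hz => ?_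
    have h1 : z ≫ r = 0 := by simpa using hz =≫ biprod.fst
    have h2 : (z ≫ q) ≫ a = 0 := by simpa using hz =≫ biprod.snd
    obtain ⟨y, rfl⟩ := h.lift z (zero_of_comp_mono a h2)
    rw [Category.assoc, hr, Category.comp_id] at h1
    rw [h1, zero_comp]
  refine IsSES.ofCokernel _ _ (by simp [h'.1]) fun {T} k hk => ?_
  have hx : x ≫ biprod.lift r (q ≫ a) = biprod.inl := by
    ext <;> simp [hr]
    rw [← Category.assoc, h.1, zero_comp]
  have h1 : biprod.inl ≫ k = 0 := by rw [← hx, Category.assoc, hk, comp_zero]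
  have h2 : q ≫ a ≫ biprod.inr ≫ k = 0 := by
    have : biprod.lift r (q ≫ a) = r ≫ biprod.inl + (q ≫ a) ≫ biprod.inr := by ext <;> simp
    rw [this] at hk
    simpa [h1] using hk
  obtain ⟨l, hl⟩ := h'.desc (biprod.inr ≫ k) (zero_of_epi_comp q h2)
  refine ⟨l, ?_⟩
  ext
  · simp [h1]
  · simp [hl]

theorem isSES_biprod (X W : A) : IsSES (biprod.inl : X ⟶ X ⊞ W) biprod.snd :=
  IsSES.ofCokernel _ _ (by simp) fun k hk => ⟨biprod.inr ≫ k, by ext <;> simp [hk]⟩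

open ZeroObject in
theorem exists_approx [EnoughProjectives A] [HasExt.{v} A]
    (𝒳 𝒲 : Set A) (hX : ExtClosed 𝒳) (hcoker : CokerClosed 𝒳)
    (hgen : IsGen 𝒲 𝒳) (hproj : IsXProj 𝒲 𝒳) (n : ℕ) : ∀ {K : A}, HasCoresLE 𝒳 n K →
    ∃ (X Y : A) (f : K ⟶ X) (g : X ⟶ Y), X ∈ 𝒳 ∧ IsSES f g ∧ LeftOrth 𝒳 Y ∧
      ∃ m, HasCoresLE 𝒳 m Y := by
  induction n with
  | zero =>
    intro K hK
    have hs : IsSES (𝟙 K) (0 : K ⟶ 0) :=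
      IsSES.ofCokernel _ _ (by simp) fun k hk => ⟨0, by simpa using hk.symm⟩
    refine ⟨K, 0, 𝟙 K, 0, hK, hs, ?_, 0, hcoker _ _ hs hK hK⟩
    intro X _ i
    refine subsingleton_of_forall_eq 0 fun α => ?_
    rw [← Abelian.Ext.mk₀_id_comp α, (isZero_zero A).eq_of_src (𝟙 (0 : A)) 0]
    simp
  | succ n ih =>
    rintro K ⟨X₀, L, s, t, hX₀, hst, hL⟩
    obtain ⟨X₁, Y, l, y, hX₁, hly, hY, m, hm⟩ := ih hL
    obtain ⟨X', W, u, w, hW, hX', huw⟩ := hgen.2 X₁ hX₁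
    obtain ⟨Q, a, b, c, d, hab, hcd⟩ := huw.third' hly
    have := hst.epi
    have := hab.epi
    have sq := IsPullback.of_hasPullback t b
    obtain ⟨p, hp⟩ := hst.pullback sq
    obtain ⟨p', hp'⟩ := hab.pullback sq.flip
    refine ⟨_, Q, _, _, hX _ _ hp' hX' hX₀, hp, LeftOrth.of_ses hcd ?_ hY, m + 1,
      W, Y, c, d, hgen.1 hW, hcd, hm⟩
    exact fun X hX i => ext_subsingleton_of_vanish i (hproj W hW X hX (i + 1) (by lia))

/-- Lemma 3.8, abelian version. -/
theorem stmt5 [EnoughProjectives A] [EnoughInjectives A]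
    (𝒳 𝒲 : Set A) (hX : ExtClosed 𝒳) (hcoker : CokerClosed 𝒳)
    (hgen : IsGen 𝒲 𝒳) (hproj : IsXProj 𝒲 𝒳)
    {K X C : A} (f : K ⟶ X) (g : X ⟶ C) (hses : IsSES f g) (hXmem : X ∈ 𝒳) :
    (∃ n, HasCoresLE 𝒳 n C) ↔ (∃ n, HasCoresLE 𝒳 n K) := by
  constructor
  · rintro ⟨n, hn⟩
    exact ⟨n + 1, X, C, f, g, hXmem, hses, hn⟩
  · rintro ⟨n, hn⟩
    have : HasExt.{v} A := hasExt_of_enoughProjectives.{v} A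
    obtain ⟨X', Y, s, t, hX', hst, hY, m, hm⟩ :=
      exists_approx 𝒳 𝒲 hX hcoker hgen hproj n hn
    have := hses.mono
    have := hst.mono
    have sq := IsPushout.of_hasPushout f s
    obtain ⟨p, hp⟩ := hses.pushout sq
    obtain ⟨q, hq⟩ := hst.pushout sq.flip
    cases m with
    | zero => exact ⟨0, hcoker _ _ hp hX' (hX _ _ hq hXmem hm)⟩
    | succ m =>
      obtain ⟨W, Y', a, b, hW, hab, hY'⟩ := hm
      obtain ⟨r, hr⟩ := exists_retraction hq (hY X hXmem 0)
      obtain ⟨Z, a', b', c', d', h1, h2⟩ := hp.third (isSES_of_retraction hq hr hab)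
      exact ⟨m + 1, Z, Y', c', d',
        hcoker _ _ h1 hX' (hX _ _ (isSES_biprod X W) hXmem hW), h2, hY'⟩
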